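/- For every q ∈ (1,2] there exists a constant c_q > 0, depending only on q and s, such that for every summable f : ℤ → ℝ one has ‖H(f)‖_q ≤ c_q ‖f‖_q, where H(f)(x) = (∫₀^∞ |D(P_t f)(x)|² dt)^{1/2} and Df(x) = f(x+1) − f(x). -/

import Mathlib

open MeasureTheory Real

/-- The kernel `K_s` of the fractional discrete Laplacian on `ℤ`. -/
noncomputable def Ker (s : ℝ) (m : ℤ) : ℝ :=
  if m = 0 then 0
  else ((4 : ℝ) ^ s * Real.Gamma (1 / 2 + s) / (Real.sqrt Real.pi * |Real.Gamma (-s)|)) *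
    (Real.Gamma ((m.natAbs : ℝ) - s) / Real.Gamma ((m.natAbs : ℝ) + 1 + s))

/-- The fractional discrete Laplacian `L = (-Δ)^s` acting pointwise. -/
noncomputable def Lop (s : ℝ) (f : ℤ → ℝ) : ℤ → ℝ :=
  fun x => ∑' y : ℤ, (f x - f y) * Ker s (x - y)

/-- The heat semigroup `P_t = exp (-t L)`, given by the exponential series of the
bounded operator `-tL` (evaluated pointwise). -/
noncomputable def heat (s t : ℝ) (f : ℤ → ℝ) : ℤ → ℝ :=
  fun x => ∑' n : ℕ, ((-t) ^ n / (n.factorial : ℝ)) * ((Lop s)^[n] f x)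

/-- The squared modulus of the gradient, `|∇f|²(x) = Σ_y K_s(y-x) (f x - f y)²`. -/
noncomputable def gradSq (s : ℝ) (f : ℤ → ℝ) (x : ℤ) : ℝ :=
  ∑' y : ℤ, Ker s (y - x) * (f x - f y) ^ 2

/-- The squared modulus of the modified gradient,
`|∇̃f|²(x) = Σ_{y : |f y| < |f x|} K_s(y-x) (f x - f y)²`. -/
noncomputable def mgradSq (s : ℝ) (f : ℤ → ℝ) (x : ℤ) : ℝ :=
  ∑' y : {y : ℤ // |f y| < |f x|}, Ker s ((y : ℤ) - x) * (f x - f (y : ℤ)) ^ 2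

/-- The `ℓ^q` norm on `ℤ` with counting measure (for finite `q`). -/
noncomputable def lqNorm (q : ℝ) (f : ℤ → ℝ) : ℝ :=
  (∑' x : ℤ, |f x| ^ q) ^ (1 / q)


/-! ### The kernel -/

lemma gamma_natCast_sub_pos {s : ℝ} (hs : s ∈ Set.Ioo (0 : ℝ) 1) {n : ℕ} (hn : n ≠ 0) :
    0 < Real.Gamma ((n : ℝ) - s) := by
  have : (1 : ℝ) ≤ n := by exact_mod_cast Nat.one_le_iff_ne_zero.mpr hn
  exact Real.Gamma_pos_of_pos (by linarith [hs.2])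

lemma gamma_natCast_add_pos {s : ℝ} (hs : s ∈ Set.Ioo (0 : ℝ) 1) (n : ℕ) :
    0 < Real.Gamma ((n : ℝ) + 1 + s) :=
  Real.Gamma_pos_of_pos (by have := hs.1; positivity)

lemma ker_const_pos {s : ℝ} (hs : s ∈ Set.Ioo (0 : ℝ) 1) :
    0 < (4 : ℝ) ^ s * Real.Gamma (1 / 2 + s) / (Real.sqrt Real.pi * |Real.Gamma (-s)|) := by
  have h1 : 0 < Real.Gamma (1 / 2 + s) := Real.Gamma_pos_of_pos (by linarith [hs.1])
  have h2 : Real.Gamma (-s) ≠ 0 := by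
    refine Real.Gamma_ne_zero fun m hm => ?_
    have hm' : s = m := by linarith
    have h0 := hs.1
    have h1 := hs.2
    rw [hm'] at h0 h1
    norm_cast at h0 h1
    omega
  have h3 : 0 < |Real.Gamma (-s)| := abs_pos.mpr h2
  positivity

lemma ker_zero (s : ℝ) : Ker s 0 = 0 := by simp [Ker]

lemma ker_neg (s : ℝ) (m : ℤ) : Ker s (-m) = Ker s m := by simp [Ker]

lemma ker_pos {s : ℝ} (hs : s ∈ Set.Ioo (0 : ℝ) 1) {m : ℤ} (hm : m ≠ 0) : 0 < Ker s m := by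
  rw [Ker, if_neg hm]
  exact mul_pos (ker_const_pos hs)
    (div_pos (gamma_natCast_sub_pos hs (by simpa using hm)) (gamma_natCast_add_pos hs _))

lemma ker_natCast_succ_le {s : ℝ} (hs : s ∈ Set.Ioo (0 : ℝ) 1) {n : ℕ} (hn : n ≠ 0) :
    Ker s ((n + 1 : ℕ) : ℤ) ≤ Ker s (n : ℤ) := by
  have hs0 := hs.1
  have h1 : (1 : ℝ) ≤ n := by exact_mod_cast Nat.one_le_iff_ne_zero.mpr hn
  have hn' : ((n : ℤ)) ≠ 0 := by exact_mod_cast hn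
  rw [Ker, Ker, if_neg (by positivity), if_neg hn']
  refine mul_le_mul_of_nonneg_left ?_ (ker_const_pos hs).le
  simp only [Int.natAbs_natCast]
  have e1 : Real.Gamma (((n + 1 : ℕ) : ℝ) - s) = (n - s) * Real.Gamma (n - s) := by
    rw [← Real.Gamma_add_one (by linarith [hs.2])]; push_cast; ring_nf
  have e2 : Real.Gamma (((n + 1 : ℕ) : ℝ) + 1 + s) = (n + 1 + s) * Real.Gamma (n + 1 + s) := by
    rw [← Real.Gamma_add_one (by positivity)]; push_cast; ring_nf
  have p1 := gamma_natCast_sub_pos hs hn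
  have p2 := gamma_natCast_add_pos hs n
  rw [e1, e2, mul_div_mul_comm]
  refine mul_le_of_le_one_left (div_pos p1 p2).le ?_
  rw [div_le_one (by positivity)]
  linarith

lemma summable_ker_natCast_succ {s : ℝ} (hs : s ∈ Set.Ioo (0 : ℝ) 1) :
    Summable fun n : ℕ => Ker s ((n : ℤ) + 1) := by
  have hs0 := hs.1
  have hs1 := hs.2
  set w : ℕ → ℝ := fun n => Real.Gamma (n + 1 - s) / Real.Gamma (n + 1 + s) with hw
  have hw0 : ∀ n, 0 ≤ w n := fun n =>
    (div_pos (Real.Gamma_pos_of_pos (by have : (0 : ℝ) ≤ n := by positivity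
                                        linarith))
      (Real.Gamma_pos_of_pos (by positivity))).le
  set r : ℕ → ℝ := fun n => Real.Gamma (n + 1 - s) / Real.Gamma (n + 1 + 1 + s) with hr
  have hr0 : ∀ n, 0 ≤ r n := fun n =>
    (div_pos (Real.Gamma_pos_of_pos (by have : (0 : ℝ) ≤ n := by positivity
                                        linarith))
      (Real.Gamma_pos_of_pos (by positivity))).le
  have key : ∀ n, 2 * s * r n = w n - w (n + 1) := by
    intro n
    have hn : (0 : ℝ) ≤ n := by positivity
    have p2 : 0 < Real.Gamma (n + 1 + s) := Real.Gamma_pos_of_pos (by positivity)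
    have e1 : Real.Gamma (((n + 1 : ℕ) : ℝ) + 1 - s) = (n + 1 - s) * Real.Gamma (n + 1 - s) := by
      rw [← Real.Gamma_add_one (by linarith)]; push_cast; ring_nf
    have e2 : Real.Gamma ((n : ℝ) + 1 + 1 + s) = (n + 1 + s) * Real.Gamma (n + 1 + s) := by
      rw [← Real.Gamma_add_one (by positivity)]; ring_nf
    have h3 : (n : ℝ) + 1 + s ≠ 0 := by positivity
    simp only [hw, hr]
    rw [e1, show ((n + 1 : ℕ) : ℝ) + 1 + s = n + 1 + 1 + s by push_cast; ring, e2]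
    field_simp
    ring
  have hsum : Summable r := by
    refine summable_of_sum_range_le (c := w 0 / (2 * s)) hr0 fun n => ?_
    rw [le_div_iff₀ (by positivity), mul_comm, Finset.mul_sum]
    simp_rw [key]
    rw [Finset.sum_range_sub']
    linarith [hw0 n]
  refine (hsum.mul_left ((4 : ℝ) ^ s * Real.Gamma (1 / 2 + s) /
    (Real.sqrt Real.pi * |Real.Gamma (-s)|))).congr fun n => ?_
  have h1 : ((n : ℤ) + 1) ≠ 0 := by positivity
  have h2 : ((n : ℤ) + 1).natAbs = n + 1 := by omega
  rw [Ker, if_neg h1, h2]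
  simp [hr]

lemma summable_ker {s : ℝ} (hs : s ∈ Set.Ioo (0 : ℝ) 1) : Summable (Ker s) := by
  have h := summable_ker_natCast_succ hs
  refine Summable.of_nat_of_neg_add_one ?_ ?_
  · rw [← summable_nat_add_iff 1]
    exact_mod_cast h
  · exact h.congr fun n => (ker_neg s _).symm

/-- The kernel `Ker s`, with its value at the origin raised to `Ker s 1`, which makes it even and
decreasing in `|m|`. -/
noncomputable def symKer (s : ℝ) (m : ℤ) : ℝ := if m = 0 then Ker s 1 else Ker s m

/-- Even and nonincreasing away from the origin. -/
def SymmDecreasing (p : ℤ → ℝ) : Prop :=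
  ∀ x y : ℤ, |x| ≤ |y| → p y ≤ p x

lemma SymmDecreasing.even {p : ℤ → ℝ} (hp : SymmDecreasing p) (x : ℤ) : p (-x) = p x :=
  le_antisymm (hp _ _ (by simp)) (hp _ _ (by simp))

lemma symmDecreasing_of_succ_le {p : ℤ → ℝ} (he : ∀ x, p (-x) = p x)
    (h : ∀ n : ℕ, p ((n : ℤ) + 1) ≤ p n) : SymmDecreasing p := by
  have hanti : Antitone fun n : ℕ => p n := antitone_nat_of_succ_le (by exact_mod_cast h)
  have habs : ∀ x : ℤ, p x = p (x.natAbs : ℤ) := fun x => by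
    rcases Int.natAbs_eq x with hx | hx
    · exact congrArg p hx
    · rw [← he]; exact congrArg p (by omega)
  intro x y hxy
  rw [Int.abs_eq_natAbs, Int.abs_eq_natAbs] at hxy
  rw [habs x, habs y]
  exact hanti (by omega)

lemma symKer_symmDecreasing {s : ℝ} (hs : s ∈ Set.Ioo (0 : ℝ) 1) : SymmDecreasing (symKer s) := by
  refine symmDecreasing_of_succ_le (fun x => by simp [symKer, ker_neg]) fun n => ?_
  rcases eq_or_ne n 0 with rfl | hn
  · simp [symKer]
  · have h1 : ((n : ℤ) + 1) ≠ 0 := by positivity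
    have h2 : ((n : ℤ)) ≠ 0 := by exact_mod_cast hn
    simp only [symKer, h1, h2, if_false]
    exact_mod_cast ker_natCast_succ_le hs hn

lemma symKer_pos {s : ℝ} (hs : s ∈ Set.Ioo (0 : ℝ) 1) (m : ℤ) : 0 < symKer s m := by
  unfold symKer
  split_ifs with h
  · exact ker_pos hs one_ne_zero
  · exact ker_pos hs h

lemma summable_symKer {s : ℝ} (hs : s ∈ Set.Ioo (0 : ℝ) 1) : Summable (symKer s) := by
  have h : symKer s = fun m => Ker s m + if m = 0 then Ker s 1 else 0 := by
    ext m
    by_cases hm : m = 0 <;> simp [symKer, hm, ker_zero]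
  rw [h]
  exact (summable_ker hs).add (summable_of_ne_finset_zero (s := {0}) fun m hm => by simp_all)

/-! ### The discrete Hardy–Littlewood maximal inequality -/

lemma Summable.rpow_of_nonneg {g : ℤ → ℝ} (hg0 : ∀ x, 0 ≤ g x) (hg : Summable g) {q : ℝ}
    (hq : 1 ≤ q) : Summable fun x => g x ^ q := by
  refine Summable.of_nonneg_of_le (fun x => Real.rpow_nonneg (hg0 x) q) (fun x => ?_)
    (hg.mul_left ((∑' y, g y) ^ (q - 1)))
  have h1 : g x ≤ ∑' y, g y := hg.le_tsum x fun y _ => hg0 y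
  have h2 : g x ^ q = g x ^ (q - 1) * g x := by
    rw [← Real.rpow_add_one' (hg0 x) (by linarith)]
    ring_nf
  rw [h2]
  exact mul_le_mul_of_nonneg_right
    (Real.rpow_le_rpow (hg0 x) h1 (by linarith)) (hg0 x)

lemma summable_natCast_add {g : ℤ → ℝ} (hg : Summable g) (x : ℤ) :
    Summable fun k : ℕ => g (x + k) :=
  hg.comp_injective (i := fun k : ℕ => x + k) fun a b h => by simpa using h

/-- Weak type `(1,1)` bound for one-sided averages. -/
lemma mul_card_le_tsum_of_forall_exists_lt {g : ℤ → ℝ} (hg0 : ∀ x, 0 ≤ g x) (hg : Summable g)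
    {l : ℝ} (hl : 0 ≤ l) (F : Finset ℤ)
    (hF : ∀ x ∈ F, ∃ n : ℕ, l * n < ∑ k ∈ Finset.range n, g (x + k)) :
    l * F.card ≤ ∑' x, g x := by
  classical
  set S : ℕ → ℤ → ℝ := fun n x => ∑ k ∈ Finset.range n, (g (x + k) - l) with hS
  have hSle : ∀ n x, S n x ≤ ∑' k : ℕ, g (x + k) := fun n x =>
    (Finset.sum_le_sum fun k _ => by linarith).trans
      ((summable_natCast_add hg x).sum_le_tsum _ fun k _ => hg0 _)
  have hbdd : ∀ x, BddAbove (Set.range fun n => S n x) := fun x =>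
    ⟨_, by rintro _ ⟨n, rfl⟩; exact hSle n x⟩
  have hSsucc : ∀ n x, S (n + 1) x = g x - l + S n (x + 1) := by
    intro n x
    simp only [hS, Finset.sum_range_succ' _ n]
    rw [add_comm]
    simp [add_assoc, add_comm (1 : ℤ)]
  set h : ℤ → ℝ := fun x => ⨆ n, S n x with hh
  have hle : ∀ n x, S n x ≤ h x := fun n x => le_ciSup (hbdd x) n
  have hh0 : ∀ x, 0 ≤ h x := fun x => by simpa [hS] using hle 0 x
  have hmax : ∀ x, h x ≤ max 0 (g x - l + h (x + 1)) := by
    intro x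
    refine ciSup_le fun n => ?_
    cases n with
    | zero => simp [hS]
    | succ n =>
      rw [hSsucc]
      exact le_max_of_le_right (by linarith [hle n (x + 1)])
  have hstep : ∀ x, h x + (if x ∈ F then l else 0) ≤ g x + h (x + 1) := by
    intro x
    split_ifs with hx
    · obtain ⟨n, hn⟩ := hF x hx
      have hpos : 0 < h x := by
        refine lt_of_lt_of_le ?_ (hle n x)
        simp only [hS, Finset.sum_sub_distrib, Finset.sum_const, Finset.card_range, nsmul_eq_mul]
        linarith
      rcases le_max_iff.mp (hmax x) with h1 | h1 <;> linarith
    · rcases le_max_iff.mp (hmax x) with h1 | h1 <;> linarith [hg0 x, hh0 (x + 1)]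
  have htele : ∀ (a : ℤ) (m : ℕ), h a + ∑ i ∈ Finset.range m, (if a + i ∈ F then l else 0) ≤
      ∑ i ∈ Finset.range m, g (a + i) + h (a + m) := by
    intro a m
    induction m with
    | zero => simp
    | succ m ih =>
      rw [Finset.sum_range_succ, Finset.sum_range_succ]
      have := hstep (a + m)
      rw [add_assoc a] at this
      push_cast
      linarith
  set R : ℕ := F.sup Int.natAbs with hR
  set a : ℤ := -R with ha
  set m : ℕ := 2 * R + 1 with hm
  have hcard : l * F.card ≤ ∑ i ∈ Finset.range m, (if a + i ∈ F then l else 0) := by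
    rw [← Finset.sum_filter, Finset.sum_const, nsmul_eq_mul, mul_comm]
    refine mul_le_mul_of_nonneg_right ?_ hl
    have hsub : F ⊆ ((Finset.range m).filter fun i : ℕ => a + i ∈ F).image fun i : ℕ => a + i := by
      intro x hx
      have hxR : x.natAbs ≤ R := Finset.le_sup (f := Int.natAbs) hx
      have hx' : a + ((x + R).toNat : ℤ) = x := by omega
      refine Finset.mem_image.mpr ⟨(x + R).toNat, ?_, hx'⟩
      rw [Finset.mem_filter, hx']
      exact ⟨Finset.mem_range.mpr (by omega), hx⟩
    exact_mod_cast (Finset.card_le_card hsub).trans Finset.card_image_le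
  have hend : h (a + m) ≤ ∑' k : ℕ, g (a + (k + m : ℕ)) := by
    refine (ciSup_le fun n => hSle n _).trans (le_of_eq (tsum_congr fun k => ?_))
    congr 1
    push_cast
    ring
  have htail := (summable_natCast_add hg a).sum_add_tsum_nat_add m
  have hall : ∑' k : ℕ, g (a + k) ≤ ∑' x, g x :=
    (summable_natCast_add hg a).tsum_le_tsum_of_inj (fun k : ℕ => a + k)
      (fun i j hij => by simpa using hij) (fun c _ => hg0 c) (fun _ => le_rfl) hg
  linarith [htele a m, hh0 a]

/-- The one-sided maximal function on `ℤ`. -/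
noncomputable def maxAvg (g : ℤ → ℝ) (x : ℤ) : ℝ :=
  ⨆ n : ℕ, (∑ k ∈ Finset.range (n + 1), g (x + k)) / (n + 1)

section

variable {g : ℤ → ℝ}

lemma bddAbove_avg (hg0 : ∀ x, 0 ≤ g x) (hg : Summable g) (x : ℤ) :
    BddAbove (Set.range fun n : ℕ => (∑ k ∈ Finset.range (n + 1), g (x + k)) / ((n : ℝ) + 1)) := by
  refine ⟨∑' k : ℕ, g (x + k), ?_⟩
  rintro _ ⟨n, rfl⟩
  refine (div_le_self (Finset.sum_nonneg fun k _ => hg0 _) (by simp)).trans ?_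
  exact (summable_natCast_add hg x).sum_le_tsum _ fun k _ => hg0 _

lemma sum_le_mul_maxAvg (hg0 : ∀ x, 0 ≤ g x) (hg : Summable g) (x : ℤ) (n : ℕ) :
    ∑ k ∈ Finset.range n, g (x + k) ≤ n * maxAvg g x := by
  cases n with
  | zero => simp
  | succ n =>
    have : _ ≤ maxAvg g x := le_ciSup (bddAbove_avg hg0 hg x) n
    rw [div_le_iff₀ (by positivity)] at this
    rw [mul_comm]
    push_cast
    exact this

lemma maxAvg_nonneg (hg0 : ∀ x, 0 ≤ g x) (x : ℤ) : 0 ≤ maxAvg g x :=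
  Real.iSup_nonneg fun _ => div_nonneg (Finset.sum_nonneg fun _ _ => hg0 _) (by positivity)

lemma mul_card_le_of_lt_maxAvg (hg0 : ∀ x, 0 ≤ g x) (hg : Summable g) {t : ℝ}
    (ht : 0 < t) (F : Finset ℤ) (hF : ∀ x ∈ F, t < maxAvg g x) :
    t / 2 * F.card ≤ ∑' x, {x | t < 2 * g x}.indicator g x := by
  refine mul_card_le_tsum_of_forall_exists_lt
    (fun x => Set.indicator_nonneg (fun x _ => hg0 x) x) (hg.indicator _) (by positivity) F
    fun x hx => ?_
  obtain ⟨n, hn⟩ := exists_lt_of_lt_ciSup (hF x hx)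
  refine ⟨n + 1, ?_⟩
  rw [lt_div_iff₀ (by positivity)] at hn
  have h1 : ∑ k ∈ Finset.range (n + 1), (g (x + k) - t / 2) ≤
      ∑ k ∈ Finset.range (n + 1), {x | t < 2 * g x}.indicator g (x + k) := by
    refine Finset.sum_le_sum fun k _ => ?_
    by_cases hk : t < 2 * g (x + k)
    · rw [Set.indicator_of_mem (by exact hk)]
      linarith
    · rw [Set.indicator_of_notMem (by exact hk)]
      linarith
  rw [Finset.sum_sub_distrib, Finset.sum_const, Finset.card_range, nsmul_eq_mul] at h1
  push_cast at h1 ⊢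
  linarith

lemma count_lt_maxAvg_mul_le (hg0 : ∀ x, 0 ≤ g x) (hg : Summable g) {t : ℝ} (ht : 0 < t) :
    Measure.count {x | t < maxAvg g x} * ENNReal.ofReal t ≤
      2 * (Measure.count.withDensity fun x => ENNReal.ofReal (g x)) {x | t < 2 * g x} := by
  set G := ∑' x, {x | t < 2 * g x}.indicator g x with hG
  have hfin : {x | t < maxAvg g x}.Finite := by
    by_contra hinf
    obtain ⟨N, hN⟩ := exists_nat_gt (G / (t / 2))
    obtain ⟨F, hFS, hFN⟩ := Set.Infinite.exists_subset_card_eq hinf N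
    have := mul_card_le_of_lt_maxAvg hg0 hg ht F fun x hx => hFS hx
    rw [div_lt_iff₀ (by positivity)] at hN
    rw [hFN] at this
    linarith
  have h1 := mul_card_le_of_lt_maxAvg hg0 hg ht hfin.toFinset fun x hx => by simpa using hx
  have h2 : (Measure.count.withDensity fun x => ENNReal.ofReal (g x)) {x | t < 2 * g x} =
      ENNReal.ofReal G := by
    rw [withDensity_apply _ (MeasurableSet.of_discrete), ← lintegral_indicator
      (MeasurableSet.of_discrete), lintegral_count, hG, ENNReal.ofReal_tsum_of_nonneg
      (fun x => Set.indicator_nonneg (fun x _ => hg0 x) x) (hg.indicator _)]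
    refine tsum_congr fun x => ?_
    by_cases hx : t < 2 * g x
    · rw [Set.indicator_of_mem (by exact hx), Set.indicator_of_mem (by exact hx)]
    · rw [Set.indicator_of_notMem (by exact hx), Set.indicator_of_notMem (by exact hx)]
      simp
  rw [h2, Measure.count_apply_finite _ hfin, ← ENNReal.ofReal_natCast,
    ← ENNReal.ofReal_mul (by positivity), show (2 : ENNReal) = ENNReal.ofReal 2 by simp,
    ← ENNReal.ofReal_mul (by positivity)]
  exact ENNReal.ofReal_le_ofReal (by linarith)

lemma sum_maxAvg_rpow_le (hg0 : ∀ x, 0 ≤ g x) (hg : Summable g) {q : ℝ} (hq : 1 < q)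
    (F : Finset ℤ) :
    ∑ x ∈ F, maxAvg g x ^ q ≤ q * 2 ^ q / (q - 1) * ∑' x, g x ^ q := by
  set ν := Measure.count.withDensity fun x => ENNReal.ofReal (g x) with hν
  have hq1 : 0 < q - 1 := by linarith
  have hC : 0 ≤ q * 2 ^ q / (q - 1) := by positivity
  have L1 := lintegral_rpow_eq_lintegral_meas_lt_mul (Measure.count : Measure ℤ)
    (f := maxAvg g) (Filter.Eventually.of_forall (maxAvg_nonneg hg0))
    (Measurable.of_discrete.aemeasurable) (p := q) (by linarith)
  have L2 := lintegral_rpow_eq_lintegral_meas_lt_mul ν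
    (f := fun x => 2 * g x) (Filter.Eventually.of_forall fun x => by have := hg0 x; positivity)
    (Measurable.of_discrete.aemeasurable) hq1
  have h1 : ∫⁻ t in Set.Ioi (0 : ℝ), Measure.count {x | t < maxAvg g x} *
      ENNReal.ofReal (t ^ (q - 1)) ≤
      2 * ∫⁻ t in Set.Ioi (0 : ℝ), ν {x | t < 2 * g x} * ENNReal.ofReal (t ^ (q - 1 - 1)) := by
    rw [← lintegral_const_mul' _ _ (by simp)]
    refine setLIntegral_mono' measurableSet_Ioi fun t ht => ?_
    have ht : 0 < t := ht
    have : t ^ (q - 1) = t * t ^ (q - 1 - 1) := by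
      rw [← Real.rpow_one_add' ht.le (by linarith)]
      ring_nf
    rw [this, ENNReal.ofReal_mul ht.le, ← mul_assoc, ← mul_assoc]
    exact mul_le_mul_left (count_lt_maxAvg_mul_le hg0 hg ht) _
  have h2 : ∫⁻ x, ENNReal.ofReal ((2 * g x) ^ (q - 1)) ∂ν =
      ENNReal.ofReal (2 ^ (q - 1) * ∑' x, g x ^ q) := by
    rw [hν, lintegral_withDensity_eq_lintegral_mul _ Measurable.of_discrete
      Measurable.of_discrete, lintegral_count, ← tsum_mul_left, ENNReal.ofReal_tsum_of_nonneg
      (fun x => by have := hg0 x; positivity)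
      ((hg.rpow_of_nonneg hg0 hq.le).mul_left _)]
    refine tsum_congr fun x => ?_
    rw [Pi.mul_apply, ← ENNReal.ofReal_mul (hg0 x), Real.mul_rpow (by norm_num) (hg0 x)]
    congr 1
    have : g x ^ q = g x * g x ^ (q - 1) := by
      rw [← Real.rpow_one_add' (hg0 x) (by linarith)]
      ring_nf
    rw [this]
    ring
  rw [h2] at L2
  have h3 : 2 * ∫⁻ t in Set.Ioi (0 : ℝ), ν {x | t < 2 * g x} *
      ENNReal.ofReal (t ^ (q - 1 - 1)) =
      ENNReal.ofReal (2 ^ q / (q - 1) * ∑' x, g x ^ q) := by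
    have : (ENNReal.ofReal (q - 1)) ≠ 0 := by simpa using hq
    rw [← ENNReal.mul_right_inj this ENNReal.ofReal_ne_top, mul_left_comm, ← L2,
      ← ENNReal.ofReal_mul hq1.le, show (2 : ENNReal) = ENNReal.ofReal 2 by simp,
      ← ENNReal.ofReal_mul (by norm_num)]
    congr 1
    have : (2 : ℝ) ^ q = 2 * 2 ^ (q - 1) := by
      rw [← Real.rpow_one_add' (by norm_num) (by linarith)]
      ring_nf
    rw [this]
    field_simp
  rw [h3] at h1
  have h4 : ENNReal.ofReal (∑ x ∈ F, maxAvg g x ^ q) ≤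
      ENNReal.ofReal (q * 2 ^ q / (q - 1) * ∑' x, g x ^ q) := by
    rw [ENNReal.ofReal_sum_of_nonneg fun x _ => Real.rpow_nonneg (maxAvg_nonneg hg0 x) q]
    refine (ENNReal.sum_le_tsum F).trans ?_
    rw [← lintegral_count, L1, show q * 2 ^ q / (q - 1) * ∑' x, g x ^ q =
      q * (2 ^ q / (q - 1) * ∑' x, g x ^ q) by ring, ENNReal.ofReal_mul (by linarith)]
    exact mul_le_mul_right h1 _
  exact (ENNReal.ofReal_le_ofReal_iff
    (mul_nonneg hC (tsum_nonneg fun x => Real.rpow_nonneg (hg0 x) q))).mp h4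

/-- A common majorant of the averages over intervals starting or ending near a given point,
bounded in `ℓ^q`. -/
lemma exists_maximal_majorant (hg0 : ∀ x, 0 ≤ g x) (hg : Summable g) {q : ℝ} (hq : 1 < q) :
    ∃ A : ℤ → ℝ, (∀ x, 0 ≤ A x) ∧
      (∀ x (n : ℕ), ∑ k ∈ Finset.range n, g (x + k) ≤ n * A x) ∧
      (∀ x (n : ℕ), ∑ k ∈ Finset.range n, g (x - (k + 1)) ≤ n * A x) ∧
      ∀ F : Finset ℤ, ∑ x ∈ F, A x ^ q ≤ 2 * (q * 2 ^ q / (q - 1)) * ∑' x, g x ^ q := by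
  have hg' : Summable fun x => g (-x) := (Equiv.neg ℤ).summable_iff.mpr hg
  have hg0' : ∀ x, 0 ≤ g (-x) := fun x => hg0 _
  refine ⟨fun x => max (maxAvg g x) (maxAvg (fun y => g (-y)) (1 - x)),
    fun x => le_max_of_le_left (maxAvg_nonneg hg0 x), fun x n => ?_, fun x n => ?_, fun F => ?_⟩
  · exact (sum_le_mul_maxAvg hg0 hg x n).trans
      (mul_le_mul_of_nonneg_left (le_max_left _ _) (by positivity))
  · refine le_trans (le_of_eq ?_) ((sum_le_mul_maxAvg hg0' hg' (1 - x) n).trans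
      (mul_le_mul_of_nonneg_left (le_max_right _ _) (by positivity)))
    refine Finset.sum_congr rfl fun k _ => ?_
    congr 1
    ring
  · have hinj : Set.InjOn (fun x : ℤ => 1 - x) F := fun a _ b _ h => by simpa using h
    have h1 := sum_maxAvg_rpow_le hg0 hg hq F
    have h2 := sum_maxAvg_rpow_le hg0' hg' hq (F.image fun x => 1 - x)
    have h0 : ∑' x, g (-x) ^ q = ∑' x, g x ^ q := (Equiv.neg ℤ).tsum_eq fun x => g x ^ q
    rw [Finset.sum_image hinj, h0] at h2
    have h3 : ∀ x ∈ F, max (maxAvg g x) (maxAvg (fun y => g (-y)) (1 - x)) ^ q ≤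
        maxAvg g x ^ q + maxAvg (fun y => g (-y)) (1 - x) ^ q := by
      intro x _
      have p1 := Real.rpow_nonneg (maxAvg_nonneg hg0 x) q
      have p2 := Real.rpow_nonneg (maxAvg_nonneg hg0' (1 - x)) q
      rcases max_choice (maxAvg g x) (maxAvg (fun y => g (-y)) (1 - x)) with h | h <;> rw [h] <;>
        linarith
    refine (Finset.sum_le_sum h3).trans ?_
    rw [Finset.sum_add_distrib]
    linarith

end

/-! ### The heat semigroup on `ℓ¹(ℤ)` -/

/-- The space `ℓ¹(ℤ)`. -/
abbrev L1Z := lp (fun _ : ℤ => ℝ) 1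

lemma hasSum_abs_L1Z (f : L1Z) : HasSum (fun x => |f x|) ‖f‖ := by
  simpa using lp.hasSum_norm (p := 1) (by simp) f

lemma summable_abs_L1Z (f : L1Z) : Summable fun x => |f x| := (hasSum_abs_L1Z f).summable

lemma summable_L1Z (f : L1Z) : Summable fun x => f x := (summable_abs_L1Z f).of_abs

lemma abs_apply_le_norm_L1Z (f : L1Z) (x : ℤ) : |f x| ≤ ‖f‖ :=
  le_hasSum (hasSum_abs_L1Z f) x fun _ _ => abs_nonneg _

/-- A summable function as an element of `ℓ¹(ℤ)`. -/
def L1Z.ofSummable (f : ℤ → ℝ) (hf : Summable f) : L1Z :=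
  ⟨f, memℓp_gen (by simpa using hf.abs)⟩

@[simp] lemma L1Z.ofSummable_apply (f : ℤ → ℝ) (hf : Summable f) (x : ℤ) :
    L1Z.ofSummable f hf x = f x := rfl

/-- Evaluation at a point as a continuous linear functional on `ℓ¹(ℤ)`. -/
noncomputable abbrev evalL (x : ℤ) : L1Z →L[ℝ] ℝ := lp.evalCLM ℝ (fun _ : ℤ => ℝ) 1 x

/-- Translation on `ℓ¹(ℤ)`. -/
noncomputable def translateL (y : ℤ) : L1Z →L[ℝ] L1Z :=
  LinearMap.mkContinuous
    { toFun := fun f => L1Z.ofSummable (fun x => f (x - y))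
        ((Equiv.subRight y).summable_iff.mpr (summable_L1Z f))
      map_add' := fun _ _ => rfl
      map_smul' := fun _ _ => rfl } 1 fun f => by
    rw [one_mul]
    exact le_of_eq (HasSum.unique (hasSum_abs_L1Z _)
      ((Equiv.subRight y).hasSum_iff.mpr (hasSum_abs_L1Z f)))

lemma translateL_apply (y : ℤ) (f : L1Z) (x : ℤ) : translateL y f x = f (x - y) := rfl

lemma norm_translateL_le (y : ℤ) : ‖translateL y‖ ≤ 1 :=
  LinearMap.mkContinuous_norm_le _ zero_le_one _

/-- Convolution with `b` on `ℓ¹(ℤ)`. -/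
noncomputable def convOp (b : ℤ → ℝ) : L1Z →L[ℝ] L1Z := ∑' y, b y • translateL y

section

variable {b : ℤ → ℝ}

lemma norm_smul_translateL_le (b : ℤ → ℝ) (y : ℤ) : ‖b y • translateL y‖ ≤ |b y| := by
  rw [norm_smul, Real.norm_eq_abs]
  exact mul_le_of_le_one_right (abs_nonneg _) (norm_translateL_le y)

lemma hasSum_convOp (hb : Summable b) : HasSum (fun y => b y • translateL y) (convOp b) :=
  (Summable.of_norm_bounded hb.abs (norm_smul_translateL_le b)).hasSum

lemma hasSum_convOp_apply (hb : Summable b) (f : L1Z) :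
    HasSum (fun y => b y • translateL y f) (convOp b f) :=
  (hasSum_convOp hb).mapL (ContinuousLinearMap.apply ℝ L1Z f)

lemma hasSum_convOp_apply_apply (hb : Summable b) (f : L1Z) (x : ℤ) :
    HasSum (fun y => b y * f (x - y)) (convOp b f x) :=
  (hasSum_convOp_apply hb f).mapL (evalL x)

lemma norm_convOp_le (hb : Summable b) (hb0 : ∀ y, 0 ≤ b y) : ‖convOp b‖ ≤ ∑' y, b y := by
  refine (hasSum_convOp hb).norm_le_of_bounded hb.hasSum fun y => ?_
  exact (norm_smul_translateL_le b y).trans_eq (abs_of_nonneg (hb0 y))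

lemma commute_translateL_convOp (hb : Summable b) (y : ℤ) :
    Commute (translateL y) (convOp b) := by
  refine ContinuousLinearMap.ext fun f => lp.ext (funext fun x => ?_)
  change convOp b f (x - y) = convOp b (translateL y f) x
  refine (hasSum_convOp_apply_apply hb f (x - y)).unique ?_
  convert hasSum_convOp_apply_apply hb (translateL y f) x using 4 with z
  rw [translateL_apply, sub_right_comm]

lemma convOp_nonneg (hb : Summable b) (hb0 : ∀ y, 0 ≤ b y) {f : L1Z} (hf : ∀ x, 0 ≤ f x) (x : ℤ) :
    0 ≤ convOp b f x :=
  (hasSum_convOp_apply_apply hb f x).nonneg fun _ => mul_nonneg (hb0 _) (hf _)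

/-- The convolution of two even decreasing functions is even and decreasing. -/
lemma convOp_symmDecreasing (hb : Summable b) (hbs : SymmDecreasing b) {f : L1Z}
    (hf : SymmDecreasing f) : SymmDecreasing (convOp b f) := by
  refine symmDecreasing_of_succ_le (fun x => ?_) fun n => ?_
  · refine HasSum.unique ?_ (hasSum_convOp_apply_apply hb f x)
    convert (Equiv.neg ℤ).hasSum_iff.mpr (hasSum_convOp_apply_apply hb f (-x)) using 1
    ext y
    simp only [Function.comp_apply, Equiv.neg_apply, hbs.even]
    rw [← hf.even (x - y), neg_sub', sub_neg_eq_add]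
  · set x : ℤ := (n : ℤ) with hx
    have h1 := (hasSum_convOp_apply_apply hb f x).sub (hasSum_convOp_apply_apply hb f (x + 1))
    have h2 := (Equiv.subLeft (2 * x + 1)).hasSum_iff.mpr h1
    have h3 := h1.add h2
    have h4 := h3.nonneg fun y => ?_
    · linarith
    · simp only [Function.comp_apply, Equiv.subLeft_apply]
      have e1 : f (x - (2 * x + 1 - y)) = f (x + 1 - y) := by
        rw [← hf.even]; exact congrArg (fun z => f z) (by ring)
      have e2 : f (x + 1 - (2 * x + 1 - y)) = f (x - y) := by
        rw [← hf.even]; exact congrArg (fun z => f z) (by ring)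
      rw [e1, e2]
      have e3 : b y * f (x - y) - b y * f (x + 1 - y) +
          (b (2 * x + 1 - y) * f (x + 1 - y) - b (2 * x + 1 - y) * f (x - y)) =
          (b y - b (2 * x + 1 - y)) * (f (x - y) - f (x + 1 - y)) := by ring
      rw [e3]
      rcases le_or_gt y x with hy | hy
      · exact mul_nonneg (sub_nonneg.mpr (hbs _ _ (by grind)))
          (sub_nonneg.mpr (hf _ _ (by grind)))
      · exact mul_nonneg_of_nonpos_of_nonpos (sub_nonpos.mpr (hbs _ _ (by grind)))
          (sub_nonpos.mpr (hf _ _ (by grind)))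

/-- The unit mass at the origin. -/
noncomputable def deltaZero : L1Z := lp.single 1 0 1

lemma deltaZero_apply (x : ℤ) : deltaZero x = if x = 0 then 1 else 0 := by
  simp [deltaZero, lp.single_apply, Pi.single_apply]

lemma norm_deltaZero : ‖deltaZero‖ = 1 := by
  simp [deltaZero, lp.norm_single]

lemma deltaZero_symmDecreasing : SymmDecreasing deltaZero := by
  intro x y h
  rw [deltaZero_apply, deltaZero_apply]
  split_ifs with h1 h2 <;> try norm_num
  subst h1
  simp at h
  contradiction

lemma convOp_pow_deltaZero (hb : Summable b) (hb0 : ∀ y, 0 ≤ b y) (hbs : SymmDecreasing b)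
    (n : ℕ) : (∀ x, 0 ≤ (convOp b ^ n) deltaZero x) ∧ SymmDecreasing ((convOp b ^ n) deltaZero) ∧
      ‖(convOp b ^ n) deltaZero‖ ≤ (∑' y, b y) ^ n := by
  induction n with
  | zero =>
    refine ⟨fun x => ?_, deltaZero_symmDecreasing, by simp [norm_deltaZero]⟩
    change 0 ≤ deltaZero x
    rw [deltaZero_apply]
    split_ifs <;> norm_num
  | succ n ih =>
    have e : (convOp b ^ (n + 1)) deltaZero = convOp b ((convOp b ^ n) deltaZero) := by
      rw [pow_succ', mul_apply_eq_comp]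
    rw [e]
    refine ⟨convOp_nonneg hb hb0 ih.1, convOp_symmDecreasing hb hbs ih.2.1, ?_⟩
    rw [pow_succ']
    exact (ContinuousLinearMap.le_opNorm _ _).trans
      (mul_le_mul (norm_convOp_le hb hb0) ih.2.2 (norm_nonneg _) (tsum_nonneg hb0))

lemma hasSum_exp_apply (B : L1Z →L[ℝ] L1Z) (f : L1Z) (t : ℝ) :
    HasSum (fun n : ℕ => (t ^ n / (n.factorial : ℝ)) • (B ^ n) f)
      (NormedSpace.exp (t • B) f) := by
  convert (NormedSpace.exp_series_hasSum_exp' (𝕂 := ℝ) (t • B)).mapL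
    (ContinuousLinearMap.apply ℝ L1Z f) using 1
  · ext1 n
    rw [smul_pow, smul_smul, div_eq_inv_mul]
    rfl
  · rfl

lemma exp_convOp_deltaZero (hb : Summable b) (hb0 : ∀ y, 0 ≤ b y) (hbs : SymmDecreasing b)
    {t : ℝ} (ht : 0 ≤ t) : (∀ x, 0 ≤ NormedSpace.exp (t • convOp b) deltaZero x) ∧
      SymmDecreasing (NormedSpace.exp (t • convOp b) deltaZero) ∧
      ‖NormedSpace.exp (t • convOp b) deltaZero‖ ≤ Real.exp (t * ∑' y, b y) := by
  have h := hasSum_exp_apply (convOp b) deltaZero t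
  have hx := fun x => h.mapL (evalL x)
  refine ⟨fun x => (hx x).nonneg fun n => ?_, fun x y hxy => hasSum_le (fun n => ?_) (hx y) (hx x),
    ?_⟩
  · exact mul_nonneg (by positivity) ((convOp_pow_deltaZero hb hb0 hbs n).1 x)
  · exact mul_le_mul_of_nonneg_left ((convOp_pow_deltaZero hb hb0 hbs n).2.1 x y hxy)
      (by positivity)
  · have hexp := NormedSpace.expSeries_div_hasSum_exp (t * ∑' y, b y)
    rw [← Real.exp_eq_exp_ℝ] at hexp
    refine h.norm_le_of_bounded hexp fun n => ?_
    rw [norm_smul, Real.norm_of_nonneg (by positivity), mul_pow, mul_div_right_comm]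
    exact mul_le_mul_of_nonneg_left (convOp_pow_deltaZero hb hb0 hbs n).2.2 (by positivity)

lemma hasSum_apply_of_commute {S : L1Z →L[ℝ] L1Z} (hS : ∀ y, Commute (translateL y) S) (f : L1Z)
    (x : ℤ) : HasSum (fun y => f y * S deltaZero (x - y)) (S f x) := by
  have h := ((lp.hasSum_single (p := 1) (by simp) f).mapL S).mapL (evalL x)
  refine h.congr_fun fun y => ?_
  have h1 : lp.single 1 y (f y) = f y • translateL y deltaZero := by
    refine lp.ext (funext fun z => ?_)
    simp [lp.single_apply, Pi.single_apply, translateL_apply, deltaZero_apply, sub_eq_zero]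
  have h2 : S (translateL y deltaZero) = translateL y (S deltaZero) :=
    (congrArg (fun T : L1Z →L[ℝ] L1Z => T deltaZero) (hS y).eq).symm
  rw [h1, map_smul, h2]
  rfl

end

lemma sum_mul_nonneg_of_antitone {p d : ℕ → ℝ} (hp0 : ∀ n, 0 ≤ p n) (hp : Antitone p)
    (hd : ∀ n, 0 ≤ ∑ i ∈ Finset.range n, d i) (n : ℕ) : 0 ≤ ∑ i ∈ Finset.range n, p i * d i := by
  have h : ∀ n, p n * ∑ i ∈ Finset.range n, d i ≤ ∑ i ∈ Finset.range n, p i * d i := by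
    intro n
    induction n with
    | zero => simp
    | succ n ih =>
      have := mul_le_mul_of_nonneg_right (hp n.le_succ) (hd (n + 1))
      rw [Finset.sum_range_succ] at this ⊢
      rw [Finset.sum_range_succ]
      simp only [Nat.succ_eq_add_one] at this
      linarith
  exact (mul_nonneg (hp0 n) (hd n)).trans (h n)

lemma tsum_mul_le_of_antitone {p g : ℕ → ℝ} (hp0 : ∀ n, 0 ≤ p n) (hp : Antitone p)
    (hps : Summable p) (hg0 : ∀ n, 0 ≤ g n) {A : ℝ} (hA : 0 ≤ A)
    (hg : ∀ n : ℕ, ∑ i ∈ Finset.range n, g i ≤ n * A) : ∑' n, p n * g n ≤ A * ∑' n, p n := by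
  refine Real.tsum_le_of_sum_range_le (fun n => mul_nonneg (hp0 n) (hg0 n)) fun n => ?_
  have h := sum_mul_nonneg_of_antitone (d := fun i => A - g i) hp0 hp (fun n => by
    rw [Finset.sum_sub_distrib, Finset.sum_const, Finset.card_range, nsmul_eq_mul]
    linarith [hg n]) n
  simp only [mul_sub, Finset.sum_sub_distrib, ← Finset.sum_mul] at h
  have h2 := mul_le_mul_of_nonneg_right (hps.sum_le_tsum (Finset.range n) fun i _ => hp0 i) hA
  linarith

/-- Averaging against an even decreasing weight is controlled by averages over intervals. -/
lemma hasSum_mul_le_of_symmDecreasing {p g : ℤ → ℝ} (hp0 : ∀ x, 0 ≤ p x) (hp : SymmDecreasing p)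
    (hps : Summable p) (hg0 : ∀ x, 0 ≤ g x) {A S : ℝ} (hA : 0 ≤ A)
    (hg : ∀ n : ℕ, ∑ k ∈ Finset.range n, g k ≤ n * A)
    (hg' : ∀ n : ℕ, ∑ k ∈ Finset.range n, g (-((k : ℤ) + 1)) ≤ n * A)
    (hS : HasSum (fun k => p k * g k) S) : S ≤ A * ∑' k, p k := by
  have hi : Function.Injective fun n : ℕ => (n : ℤ) := Nat.cast_injective
  have hi' : Function.Injective fun n : ℕ => -((n : ℤ) + 1) := fun a b h => by simpa using h
  have hps1 : Summable fun n : ℕ => p n := hps.comp_injective hi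
  have hps2 : Summable fun n : ℕ => p (-((n : ℤ) + 1)) := hps.comp_injective hi'
  have hs1 : Summable fun n : ℕ => p n * g n := hS.summable.comp_injective hi
  have hs2 : Summable fun n : ℕ => p (-((n : ℤ) + 1)) * g (-((n : ℤ) + 1)) :=
    hS.summable.comp_injective hi'
  have e1 := tsum_of_nat_of_neg_add_one (f := fun k => p k * g k) hs1 hs2
  have e2 := tsum_of_nat_of_neg_add_one hps1 hps2
  rw [← hS.tsum_eq, e1, e2, mul_add]
  refine add_le_add ?_ ?_
  · refine tsum_mul_le_of_antitone (fun n => hp0 _) (fun a b h => hp _ _ ?_) hps1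
      (fun n => hg0 _) hA hg
    rw [Nat.abs_cast, Nat.abs_cast]
    exact_mod_cast h
  · refine tsum_mul_le_of_antitone (fun n => hp0 _) (fun a b h => hp _ _ ?_) hps2
      (fun n => hg0 _) hA hg'
    rw [abs_neg, abs_neg, abs_of_nonneg (by positivity), abs_of_nonneg (by positivity)]
    exact_mod_cast Nat.succ_le_succ h

/-- The fractional discrete Laplacian as a bounded operator on `ℓ¹(ℤ)`. -/
noncomputable def genOp (s : ℝ) : L1Z →L[ℝ] L1Z :=
  (∑' y, symKer s y) • (1 : L1Z →L[ℝ] L1Z) - convOp (symKer s)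

/-- The heat semigroup as a family of bounded operators on `ℓ¹(ℤ)`. -/
noncomputable def heatOp (s t : ℝ) : L1Z →L[ℝ] L1Z := NormedSpace.exp (t • (-genOp s))

section

variable {s : ℝ}

lemma hasSum_genOp (hs : s ∈ Set.Ioo (0 : ℝ) 1) (f : L1Z) :
    HasSum (fun z => symKer s z • (f - translateL z f)) (genOp s f) := by
  have h := ((summable_symKer hs).hasSum.smul_const f).sub
    (hasSum_convOp_apply (summable_symKer hs) f)
  simp_rw [← smul_sub] at h
  exact h

lemma Lop_eq_genOp (hs : s ∈ Set.Ioo (0 : ℝ) 1) (f : L1Z) : Lop s f = genOp s f := by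
  ext x
  have h := (Equiv.subLeft x).hasSum_iff.mpr ((hasSum_genOp hs f).mapL (evalL x))
  refine (h.congr_fun fun y => ?_).tsum_eq
  change _ = symKer s (x - y) * (f x - f (x - (x - y)))
  rw [sub_sub_cancel, mul_comm]
  rcases eq_or_ne x y with rfl | hxy
  · simp
  · rw [symKer, if_neg (sub_ne_zero.mpr hxy)]

lemma Lop_iterate_eq (hs : s ∈ Set.Ioo (0 : ℝ) 1) (f : L1Z) (n : ℕ) :
    (Lop s)^[n] f = (genOp s ^ n) f := by
  induction n with
  | zero => rfl
  | succ n ih =>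
    rw [Function.iterate_succ_apply', ih, Lop_eq_genOp hs, pow_succ', mul_apply_eq_comp]

lemma heat_eq_heatOp (hs : s ∈ Set.Ioo (0 : ℝ) 1) (f : L1Z) (t : ℝ) :
    heat s t f = heatOp s t f := by
  ext x
  have h := (hasSum_exp_apply (genOp s) f (-t)).mapL (evalL x)
  rw [heatOp, smul_neg, ← neg_smul]
  refine (h.congr_fun fun n => ?_).tsum_eq
  rw [Lop_iterate_eq hs]
  rfl

lemma heatOp_eq_smul (s t : ℝ) : heatOp s t =
    Real.exp (-(t * ∑' y, symKer s y)) • NormedSpace.exp (t • convOp (symKer s)) := by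
  let _ : NormedAlgebra ℚ (L1Z →L[ℝ] L1Z) := NormedAlgebra.restrictScalars ℚ ℝ _
  have h1 : t • (-genOp s) = algebraMap ℝ (L1Z →L[ℝ] L1Z) (-(t * ∑' y, symKer s y)) +
      t • convOp (symKer s) := by
    rw [genOp, Algebra.algebraMap_eq_smul_one, neg_sub, smul_sub, smul_smul, neg_smul]
    abel
  rw [heatOp, h1, NormedSpace.exp_add_of_commute (Algebra.commutes _ _),
    ← NormedSpace.algebraMap_exp_comm, ← Real.exp_eq_exp_ℝ]
  exact (Algebra.smul_def _ _).symm

lemma heatOp_zero (s : ℝ) : heatOp s 0 = 1 := by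
  rw [heatOp, zero_smul, NormedSpace.exp_zero]

lemma commute_translateL_heatOp (hs : s ∈ Set.Ioo (0 : ℝ) 1) (t : ℝ) (y : ℤ) :
    Commute (translateL y) (heatOp s t) := by
  rw [heatOp_eq_smul]
  exact (((commute_translateL_convOp (summable_symKer hs) y).smul_right t).exp_right).smul_right _

lemma heatOp_deltaZero (hs : s ∈ Set.Ioo (0 : ℝ) 1) {t : ℝ} (ht : 0 ≤ t) :
    (∀ x, 0 ≤ heatOp s t deltaZero x) ∧ SymmDecreasing (heatOp s t deltaZero) ∧
      ‖heatOp s t deltaZero‖ ≤ 1 := by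
  obtain ⟨h1, h2, h3⟩ := exp_convOp_deltaZero (summable_symKer hs) (fun y => (symKer_pos hs y).le)
    (symKer_symmDecreasing hs) ht
  have e : heatOp s t deltaZero = Real.exp (-(t * ∑' y, symKer s y)) •
      NormedSpace.exp (t • convOp (symKer s)) deltaZero := by
    rw [heatOp_eq_smul]
    rfl
  rw [e]
  refine ⟨fun x => mul_nonneg (Real.exp_nonneg _) (h1 x),
    fun x y hxy => mul_le_mul_of_nonneg_left (h2 x y hxy) (Real.exp_nonneg _), ?_⟩
  rw [norm_smul, Real.norm_of_nonneg (Real.exp_nonneg _), Real.exp_neg]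
  exact inv_mul_le_one_of_le₀ h3 (Real.exp_nonneg _)

lemma heatOp_nonneg (hs : s ∈ Set.Ioo (0 : ℝ) 1) {t : ℝ} (ht : 0 ≤ t) {f : L1Z}
    (hf : ∀ x, 0 ≤ f x) (x : ℤ) : 0 ≤ heatOp s t f x :=
  (hasSum_apply_of_commute (commute_translateL_heatOp hs t) f x).nonneg fun _ =>
    mul_nonneg (hf _) ((heatOp_deltaZero hs ht).1 _)

/-- The heat semigroup is pointwise controlled by the maximal function. -/
lemma heatOp_le_of_averages (hs : s ∈ Set.Ioo (0 : ℝ) 1) {t : ℝ} (ht : 0 ≤ t) {f : L1Z}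
    (hf : ∀ x, 0 ≤ f x) {x : ℤ} {A : ℝ} (hA : 0 ≤ A)
    (h1 : ∀ n : ℕ, ∑ k ∈ Finset.range n, f (x + k) ≤ n * A)
    (h2 : ∀ n : ℕ, ∑ k ∈ Finset.range n, f (x - (k + 1)) ≤ n * A) : heatOp s t f x ≤ A := by
  obtain ⟨p0, ps, pn⟩ := heatOp_deltaZero hs ht
  have h := (Equiv.addLeft x).hasSum_iff.mpr
    (hasSum_apply_of_commute (commute_translateL_heatOp hs t) f x)
  have h' : HasSum (fun k => heatOp s t deltaZero k * f (x + k)) (heatOp s t f x) := by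
    refine h.congr_fun fun k => ?_
    simp only [Function.comp_apply, Equiv.coe_addLeft]
    rw [sub_add_cancel_left, ps.even, mul_comm]
  refine (hasSum_mul_le_of_symmDecreasing p0 ps (summable_L1Z _) (fun k => hf _) hA h1
    (fun n => ?_) h').trans ?_
  · simpa only [← sub_eq_add_neg] using h2 n
  · refine mul_le_of_le_one_right hA (le_trans (le_of_eq ?_) pn)
    rw [← (hasSum_abs_L1Z _).tsum_eq]
    exact tsum_congr fun k => (abs_of_nonneg (p0 k)).symm

lemma hasDerivAt_heatOp (s t : ℝ) (f : L1Z) :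
    HasDerivAt (fun u => heatOp s u f) (-genOp s (heatOp s t f)) t :=
  ((ContinuousLinearMap.apply ℝ L1Z f).hasFDerivAt).comp_hasDerivAt t
    (hasDerivAt_exp_smul_const' (-genOp s) t)

lemma continuous_heatOp (s : ℝ) (f : L1Z) : Continuous fun t => heatOp s t f :=
  continuous_iff_continuousAt.mpr fun t => (hasDerivAt_heatOp s t f).continuousAt

lemma hasDerivAt_heatOp_apply (s t : ℝ) (f : L1Z) (x : ℤ) :
    HasDerivAt (fun u => heatOp s u f x) (-genOp s (heatOp s t f) x) t :=
  (evalL x).hasFDerivAt.comp_hasDerivAt t (hasDerivAt_heatOp s t f)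

lemma continuous_heatOp_apply (s : ℝ) (f : L1Z) (x : ℤ) : Continuous fun t => heatOp s t f x :=
  (evalL x).continuous.comp (continuous_heatOp s f)

end

/-! ### Energy estimates -/

/-- Integration against a bounded weight as a functional on `ℓ¹(ℤ)`. -/
lemma exists_weighted_sum {w : ℤ → ℝ} {R : ℝ} (hw : ∀ x, |w x| ≤ R) :
    ∃ φ : L1Z →L[ℝ] ℝ, ∀ g : L1Z, HasSum (fun x => w x * g x) (φ g) := by
  have hb : ∀ (g : L1Z) x, |w x * g x| ≤ R * |g x| := fun g x => by
    rw [abs_mul]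
    exact mul_le_mul_of_nonneg_right (hw x) (abs_nonneg _)
  have hs : ∀ g : L1Z, Summable fun x => w x * g x := fun g =>
    Summable.of_norm_bounded ((summable_abs_L1Z g).mul_left R) (hb g)
  refine ⟨LinearMap.mkContinuous
    { toFun := fun g => ∑' x, w x * g x
      map_add' := fun g h => ?_
      map_smul' := fun c g => ?_ } R fun g => ?_, fun g => (hs g).hasSum⟩
  · rw [← (hs g).tsum_add (hs h)]
    exact tsum_congr fun x => mul_add _ _ _
  · rw [RingHom.id_apply, smul_eq_mul, ← tsum_mul_left]
    exact tsum_congr fun x => mul_left_comm _ _ _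
  · exact tsum_of_norm_bounded ((hasSum_abs_L1Z g).mul_left R) (hb g)

lemma sub_mul_rpow_sub_nonneg {a b r : ℝ} (ha : 0 ≤ a) (hb : 0 ≤ b) (hr : 0 ≤ r) :
    0 ≤ (a ^ r - b ^ r) * (a - b) := by
  rcases le_total a b with h | h
  · exact mul_nonneg_of_nonpos_of_nonpos
      (sub_nonpos.mpr (Real.rpow_le_rpow ha h hr)) (sub_nonpos.mpr h)
  · exact mul_nonneg (sub_nonneg.mpr (Real.rpow_le_rpow hb h hr)) (sub_nonneg.mpr h)

/-- The Dirichlet form of `v ^ r` and `v` dominates its nearest neighbour part. -/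
lemma sum_neighbour_le_tsum_rpow_mul_genOp {s : ℝ} (hs : s ∈ Set.Ioo (0 : ℝ) 1) {v : L1Z}
    (hv : ∀ x, 0 ≤ v x) {r : ℝ} (hr : 0 ≤ r) (F : Finset ℤ) :
    symKer s 1 * ∑ x ∈ F, (v (x + 1) ^ r - v x ^ r) * (v (x + 1) - v x) ≤
      2 * ∑' x, v x ^ r * genOp s v x := by
  obtain ⟨φ, hφ⟩ := exists_weighted_sum (w := fun x => v x ^ r) (R := ‖v‖ ^ r) fun x => by
    rw [abs_of_nonneg (Real.rpow_nonneg (hv x) r)]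
    exact Real.rpow_le_rpow (hv x) ((le_abs_self _).trans (abs_apply_le_norm_L1Z v x)) hr
  have h1 : HasSum (fun z => symKer s z * φ (v - translateL z v)) (φ (genOp s v)) := by
    simpa using (hasSum_genOp hs v).mapL φ
  have h2 : HasSum (fun z => symKer s z * φ (v - translateL (-z) v)) (φ (genOp s v)) := by
    refine ((Equiv.neg ℤ).hasSum_iff.mpr h1).congr_fun fun z => ?_
    simp [(symKer_symmDecreasing hs).even]
  have h3 := h1.add h2
  have key : ∀ z, HasSum (fun x => (v x ^ r - v (x - z) ^ r) * (v x - v (x - z)))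
      (φ (v - translateL z v) + φ (v - translateL (-z) v)) := by
    intro z
    refine ((hφ (v - translateL z v)).add ((Equiv.subRight z).hasSum_iff.mpr
      (hφ (v - translateL (-z) v)))).congr_fun fun x => ?_
    change _ = v x ^ r * (v x - v (x - z)) + v (x - z) ^ r * (v (x - z) - v (x - z - -z))
    rw [sub_neg_eq_add, sub_add_cancel]
    ring
  have key0 : ∀ z, 0 ≤ φ (v - translateL z v) + φ (v - translateL (-z) v) := fun z =>
    (key z).nonneg fun x => sub_mul_rpow_sub_nonneg (hv _) (hv _) hr
  have h4 := le_hasSum h3 1 fun z _ => by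
    rw [← mul_add]
    exact mul_nonneg (symKer_pos hs z).le (key0 z)
  have h5 : ∑ x ∈ F, (v (x + 1) ^ r - v x ^ r) * (v (x + 1) - v x) ≤
      φ (v - translateL 1 v) + φ (v - translateL (-1) v) := by
    have h6 := (Equiv.addRight (1 : ℤ)).hasSum_iff.mpr (key 1)
    refine sum_le_hasSum F (fun x _ => sub_mul_rpow_sub_nonneg (hv _) (hv _) hr)
      (h6.congr_fun fun x => ?_)
    simp
  rw [(hφ (genOp s v)).tsum_eq]
  have := mul_le_mul_of_nonneg_left h5 (symKer_pos hs 1).le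
  linarith

lemma mul_sq_sub_le_rpow_mul {a b m r : ℝ} (ha : 0 ≤ a) (hb : 0 ≤ b) (ham : a ≤ m) (hbm : b ≤ m)
    (hr0 : 0 < r) (hr1 : r ≤ 1) :
    r * (a - b) ^ 2 ≤ m ^ (1 - r) * ((a ^ r - b ^ r) * (a - b)) := by
  wlog hab : b ≤ a generalizing a b
  · have := this hb ha hbm ham (le_of_not_ge hab)
    linarith
  rcases ha.eq_or_lt with rfl | ha'
  · have : b = 0 := le_antisymm hab hb
    simp [this]
  have h1 : (b / a) ^ r ≤ 1 + r * (b / a - 1) := by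
    have := rpow_one_add_le_one_add_mul_self (s := b / a - 1)
      (by have := div_nonneg hb ha; linarith) hr0.le hr1
    simpa using this
  have h2 : a ^ (1 - r) * a ^ r = a := by
    rw [← Real.rpow_add ha']
    simp
  have h3 : a ^ (1 - r) * b ^ r = a * (b / a) ^ r := by
    rw [Real.div_rpow hb ha, ← mul_div_assoc, eq_div_iff (by positivity)]
    calc a ^ (1 - r) * b ^ r * a ^ r = (a ^ (1 - r) * a ^ r) * b ^ r := by ring
      _ = a * b ^ r := by rw [h2]
  have h4 : a * (b / a) ^ r ≤ a + r * (b - a) := by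
    refine (mul_le_mul_of_nonneg_left h1 ha).trans (le_of_eq ?_)
    field_simp
  have h5 : r * (a - b) ≤ a ^ (1 - r) * (a ^ r - b ^ r) := by
    rw [mul_sub (a ^ (1 - r)), h2, h3]
    linarith
  have h6 : a ^ (1 - r) ≤ m ^ (1 - r) := Real.rpow_le_rpow ha ham (by linarith)
  calc r * (a - b) ^ 2 = r * (a - b) * (a - b) := by ring
    _ ≤ a ^ (1 - r) * (a ^ r - b ^ r) * (a - b) :=
      mul_le_mul_of_nonneg_right h5 (sub_nonneg.mpr hab)
    _ = a ^ (1 - r) * ((a ^ r - b ^ r) * (a - b)) := by ring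
    _ ≤ _ := mul_le_mul_of_nonneg_right h6 (sub_mul_rpow_sub_nonneg ha hb hr0.le)

section

variable {s q : ℝ} {f : L1Z}

/-- The time integral of the Dirichlet form of `u ^ (q - 1)` and `u` along the heat flow. -/
lemma integral_tsum_rpow_mul_genOp_le (hs : s ∈ Set.Ioo (0 : ℝ) 1) (hq : 1 < q)
    (hf : ∀ x, 0 ≤ f x) {T : ℝ} (hT : 0 ≤ T) :
    IntervalIntegrable
      (fun t => ∑' x, heatOp s t f x ^ (q - 1) * genOp s (heatOp s t f) x) volume 0 T ∧
    q * ∫ t in (0 : ℝ)..T, ∑' x, heatOp s t f x ^ (q - 1) * genOp s (heatOp s t f) x ≤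
      ∑' x, f x ^ q := by
  have hr : 0 ≤ q - 1 := by linarith
  set Z : ℤ → ℝ → ℝ := fun x t => heatOp s t f x ^ (q - 1) * genOp s (heatOp s t f) x with hZ
  have hGc : Continuous fun t => genOp s (heatOp s t f) :=
    (genOp s).continuous.comp (continuous_heatOp s f)
  have hZc : ∀ x, Continuous (Z x) := fun x =>
    ((continuous_heatOp_apply s f x).rpow_const fun _ => Or.inr hr).mul
      ((evalL x).continuous.comp hGc)
  have hBc : Continuous fun t => ‖heatOp s t f‖ ^ (q - 1) * ‖genOp s (heatOp s t f)‖ :=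
    ((continuous_heatOp s f).norm.rpow_const fun _ => Or.inr hr).mul hGc.norm
  have hsumB : ∀ t, HasSum (fun x => ‖heatOp s t f‖ ^ (q - 1) * |genOp s (heatOp s t f) x|)
      (‖heatOp s t f‖ ^ (q - 1) * ‖genOp s (heatOp s t f)‖) := fun t =>
    (hasSum_abs_L1Z _).mul_left _
  have hZB : ∀ x t, 0 ≤ t →
      ‖Z x t‖ ≤ ‖heatOp s t f‖ ^ (q - 1) * |genOp s (heatOp s t f) x| := by
    intro x t ht
    have h0 := heatOp_nonneg hs ht hf x
    rw [Real.norm_eq_abs, abs_mul, abs_of_nonneg (Real.rpow_nonneg h0 _)]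
    exact mul_le_mul_of_nonneg_right (Real.rpow_le_rpow h0
      ((le_abs_self _).trans (abs_apply_le_norm_L1Z _ x)) hr) (abs_nonneg _)
  have hZs : ∀ t, 0 ≤ t → HasSum (fun x => Z x t) (∑' x, Z x t) := fun t ht =>
    (Summable.of_norm_bounded (hsumB t).summable fun x => hZB x t ht).hasSum
  have hmem : ∀ t ∈ Set.uIoc 0 T, 0 ≤ t := fun t ht => by
    rw [Set.uIoc_of_le hT] at ht
    exact ht.1.le
  have hint : IntervalIntegrable (fun t => ∑' x, Z x t) volume 0 T := by
    refine (hBc.intervalIntegrable 0 T).mono_fun ?_ ?_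
    · refine aestronglyMeasurable_of_tendsto_ae (Filter.atTop : Filter (Finset ℤ))
        (f := fun F t => ∑ x ∈ F, Z x t)
        (fun F => (continuous_finsetSum F fun x _ => hZc x).aestronglyMeasurable) ?_
      filter_upwards [ae_restrict_mem measurableSet_uIoc] with t ht using hZs t (hmem t ht)
    · filter_upwards [ae_restrict_mem measurableSet_uIoc] with t ht
      refine (tsum_of_norm_bounded (hsumB t) fun x => hZB x t (hmem t ht)).trans (le_abs_self _)
  refine ⟨hint, ?_⟩
  have hswap := intervalIntegral.hasSum_integral_of_dominated_convergence (μ := volume)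
    (a := 0) (b := T) (F := Z) (f := fun t => ∑' x, Z x t)
    (fun x t => ‖heatOp s t f‖ ^ (q - 1) * |genOp s (heatOp s t f) x|)
    (fun x => (hZc x).aestronglyMeasurable)
    (fun x => Filter.Eventually.of_forall fun t ht => hZB x t (hmem t ht))
    (Filter.Eventually.of_forall fun t _ => (hsumB t).summable)
    (by simp_rw [(hsumB _).tsum_eq]; exact hBc.intervalIntegrable 0 T)
    (Filter.Eventually.of_forall fun t ht => hZs t (hmem t ht))
  have hFTC : ∀ x, q * ∫ t in (0 : ℝ)..T, Z x t ≤ f x ^ q := by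
    intro x
    have hd : ∀ t, HasDerivAt (fun t => heatOp s t f x ^ q) (-(q * Z x t)) t := by
      intro t
      convert (hasDerivAt_heatOp_apply s t f x).rpow_const (p := q) (Or.inr hq.le) using 1
      simp only [hZ]
      ring
    have h := intervalIntegral.integral_eq_sub_of_hasDerivAt (a := 0) (b := T)
      (fun t _ => hd t) (((hZc x).const_mul q).neg.intervalIntegrable 0 T)
    rw [intervalIntegral.integral_neg, intervalIntegral.integral_const_mul, heatOp_zero] at h
    have h0 : 0 ≤ heatOp s T f x ^ q := Real.rpow_nonneg (heatOp_nonneg hs hT hf x) q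
    have h1 : (1 : L1Z →L[ℝ] L1Z) f x = f x := rfl
    rw [h1] at h
    linarith
  exact hasSum_le hFTC (hswap.mul_left q) ((summable_L1Z f).rpow_of_nonneg hf hq.le).hasSum

/-- The nearest neighbour part of the Dirichlet form of `u ^ (q - 1)` and `u` along the heat
flow. -/
noncomputable def neighbourForm (s q : ℝ) (f : L1Z) (x : ℤ) (t : ℝ) : ℝ :=
  (heatOp s t f (x + 1) ^ (q - 1) - heatOp s t f x ^ (q - 1)) *
    (heatOp s t f (x + 1) - heatOp s t f x)

lemma neighbourForm_nonneg (hs : s ∈ Set.Ioo (0 : ℝ) 1) (hq : 1 < q) (hf : ∀ x, 0 ≤ f x) (x : ℤ)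
    {t : ℝ} (ht : 0 ≤ t) : 0 ≤ neighbourForm s q f x t :=
  sub_mul_rpow_sub_nonneg (heatOp_nonneg hs ht hf _) (heatOp_nonneg hs ht hf _) (by linarith)

lemma continuous_neighbourForm (hq : 1 < q) (x : ℤ) : Continuous (neighbourForm s q f x) := by
  have hr : 0 ≤ q - 1 := by linarith
  have h := fun y => continuous_heatOp_apply s f y
  exact (((h _).rpow_const fun _ => Or.inr hr).sub ((h _).rpow_const fun _ => Or.inr hr)).mul
    ((h _).sub (h _))

lemma sum_intervalIntegral_neighbourForm_le (hs : s ∈ Set.Ioo (0 : ℝ) 1) (hq : 1 < q)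
    (hf : ∀ x, 0 ≤ f x) {T : ℝ} (hT : 0 ≤ T) (F : Finset ℤ) :
    ∑ x ∈ F, ∫ t in (0 : ℝ)..T, neighbourForm s q f x t ≤
      2 / (q * symKer s 1) * ∑' x, f x ^ q := by
  obtain ⟨hint, hle⟩ := integral_tsum_rpow_mul_genOp_le hs hq hf hT
  have hK := symKer_pos hs 1
  rw [← intervalIntegral.integral_finsetSum fun x _ =>
    (continuous_neighbourForm hq x).intervalIntegrable 0 T]
  have h : symKer s 1 * ∫ t in (0 : ℝ)..T, ∑ x ∈ F, neighbourForm s q f x t ≤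
      2 * ∫ t in (0 : ℝ)..T, ∑' x, heatOp s t f x ^ (q - 1) * genOp s (heatOp s t f) x := by
    rw [← intervalIntegral.integral_const_mul, ← intervalIntegral.integral_const_mul]
    refine intervalIntegral.integral_mono_on hT
      ((continuous_const.mul (continuous_finsetSum F fun x _ =>
        continuous_neighbourForm hq x)).intervalIntegrable 0 T) (hint.const_mul 2) fun t ht => ?_
    exact sum_neighbour_le_tsum_rpow_mul_genOp hs (fun x => heatOp_nonneg hs ht.1 hf x)
      (by linarith) F
  rw [div_mul_eq_mul_div, le_div_iff₀ (by positivity)]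
  have := mul_le_mul_of_nonneg_left h (by linarith : (0 : ℝ) ≤ q)
  linarith

lemma integrableOn_neighbourForm (hs : s ∈ Set.Ioo (0 : ℝ) 1) (hq : 1 < q)
    (hf : ∀ x, 0 ≤ f x) (x : ℤ) : IntegrableOn (neighbourForm s q f x) (Set.Ioi 0) := by
  have hc := continuous_neighbourForm (s := s) (f := f) hq x
  refine integrableOn_Ioi_of_intervalIntegral_norm_bounded (2 / (q * symKer s 1) * ∑' x, f x ^ q) 0
    (fun T : ℝ => hc.integrableOn_Ioc) Filter.tendsto_id ?_
  filter_upwards [Filter.eventually_ge_atTop 0] with T hT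
  have h := sum_intervalIntegral_neighbourForm_le hs hq hf hT {x}
  rw [Finset.sum_singleton] at h
  refine le_trans (le_of_eq (intervalIntegral.integral_congr fun t ht => ?_)) h
  rw [id, Set.uIcc_of_le hT] at ht
  exact Real.norm_of_nonneg (neighbourForm_nonneg hs hq hf x ht.1)

lemma sum_integral_neighbourForm_le (hs : s ∈ Set.Ioo (0 : ℝ) 1) (hq : 1 < q)
    (hf : ∀ x, 0 ≤ f x) (F : Finset ℤ) :
    ∑ x ∈ F, ∫ t in Set.Ioi (0 : ℝ), neighbourForm s q f x t ≤
      2 / (q * symKer s 1) * ∑' x, f x ^ q := by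
  refine le_of_tendsto (tendsto_finsetSum F fun x _ => intervalIntegral_tendsto_integral_Ioi 0
    (integrableOn_neighbourForm hs hq hf x) Filter.tendsto_id) ?_
  filter_upwards [Filter.eventually_ge_atTop 0] with T hT
  exact sum_intervalIntegral_neighbourForm_le hs hq hf hT F

lemma integrableOn_sq_and_integral_sq_le (hs : s ∈ Set.Ioo (0 : ℝ) 1) (hq : q ∈ Set.Ioc (1 : ℝ) 2)
    (hf : ∀ x, 0 ≤ f x) {x : ℤ} {m : ℝ}
    (hm : ∀ t, 0 ≤ t → heatOp s t f x ≤ m ∧ heatOp s t f (x + 1) ≤ m) :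
    IntegrableOn (fun t => (heatOp s t f (x + 1) - heatOp s t f x) ^ 2) (Set.Ioi 0) ∧
    ∫ t in Set.Ioi (0 : ℝ), (heatOp s t f (x + 1) - heatOp s t f x) ^ 2 ≤
      (q - 1)⁻¹ * m ^ (2 - q) * ∫ t in Set.Ioi (0 : ℝ), neighbourForm s q f x t := by
  have hr : 0 < q - 1 := by linarith [hq.1]
  have hle : ∀ t ∈ Set.Ioi (0 : ℝ), (heatOp s t f (x + 1) - heatOp s t f x) ^ 2 ≤
      (q - 1)⁻¹ * m ^ (2 - q) * neighbourForm s q f x t := by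
    intro t ht
    have ht : 0 ≤ t := le_of_lt ht
    have h := mul_sq_sub_le_rpow_mul (heatOp_nonneg hs ht hf (x + 1)) (heatOp_nonneg hs ht hf x)
      (hm t ht).2 (hm t ht).1 hr (by linarith [hq.2])
    rw [show 1 - (q - 1) = 2 - q by ring] at h
    rw [mul_assoc, le_inv_mul_iff₀ hr]
    exact h
  have hJ := (integrableOn_neighbourForm hs hq.1 hf x).const_mul ((q - 1)⁻¹ * m ^ (2 - q))
  have hI : IntegrableOn (fun t => (heatOp s t f (x + 1) - heatOp s t f x) ^ 2) (Set.Ioi 0) := by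
    have hc : Continuous fun t => (heatOp s t f (x + 1) - heatOp s t f x) ^ 2 :=
      (Continuous.sub (G := ℝ) (continuous_heatOp_apply s f (x + 1))
        (continuous_heatOp_apply s f x)).pow 2
    refine Integrable.mono' hJ hc.aestronglyMeasurable ?_
    filter_upwards [ae_restrict_mem measurableSet_Ioi] with t ht
    rw [Real.norm_of_nonneg (sq_nonneg _)]
    exact hle t ht
  refine ⟨hI, ?_⟩
  rw [← integral_const_mul]
  exact setIntegral_mono_on hI hJ measurableSet_Ioi hle

/-- The `ℓ^q` estimate for nonnegative data. -/
lemma sum_integral_sq_rpow_le (hs : s ∈ Set.Ioo (0 : ℝ) 1) (hq : q ∈ Set.Ioc (1 : ℝ) 2)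
    (hf : ∀ x, 0 ≤ f x) :
    (∀ x, IntegrableOn (fun t => (heatOp s t f (x + 1) - heatOp s t f x) ^ 2) (Set.Ioi 0)) ∧
    ∀ F : Finset ℤ,
      ∑ x ∈ F, (∫ t in Set.Ioi (0 : ℝ), (heatOp s t f (x + 1) - heatOp s t f x) ^ 2) ^ (q / 2) ≤
      ((q - 1)⁻¹ ^ (q / 2) * (2 ^ q * (4 * (q * 2 ^ q / (q - 1))) + 2 / (q * symKer s 1))) *
        ∑' x, f x ^ q := by
  have hq1 := hq.1
  have hq2 := hq.2
  have hr : 0 < q - 1 := by linarith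
  obtain ⟨A, hA0, hA1, hA2, hA3⟩ := exists_maximal_majorant hf (summable_L1Z f) hq1
  have hbd : ∀ x t, 0 ≤ t → heatOp s t f x ≤ A x := fun x t ht =>
    heatOp_le_of_averages hs ht hf (hA0 x) (hA1 x) (hA2 x)
  have hmain := fun x => integrableOn_sq_and_integral_sq_le (x := x) (m := max (A x) (A (x + 1)))
    hs hq hf fun t ht => ⟨le_max_of_le_left (hbd x t ht), le_max_of_le_right (hbd (x + 1) t ht)⟩
  refine ⟨fun x => (hmain x).1, fun F => ?_⟩
  set I : ℤ → ℝ := fun x => ∫ t in Set.Ioi (0 : ℝ), neighbourForm s q f x t with hI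
  have hI0 : ∀ x, 0 ≤ I x := fun x => setIntegral_nonneg measurableSet_Ioi fun t ht =>
    neighbourForm_nonneg hs hq1 hf x (le_of_lt ht)
  have hpt : ∀ x, (∫ t in Set.Ioi (0 : ℝ), (heatOp s t f (x + 1) - heatOp s t f x) ^ 2) ^ (q / 2) ≤
      (q - 1)⁻¹ ^ (q / 2) * (A x ^ q + A (x + 1) ^ q + I x) := by
    intro x
    have hm0 : 0 ≤ max (A x) (A (x + 1)) := le_max_of_le_left (hA0 x)
    have hmq : max (A x) (A (x + 1)) ^ q ≤ A x ^ q + A (x + 1) ^ q := by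
      have p1 := Real.rpow_nonneg (hA0 x) q
      have p2 := Real.rpow_nonneg (hA0 (x + 1)) q
      rcases max_choice (A x) (A (x + 1)) with h | h <;> rw [h] <;> linarith
    refine (Real.rpow_le_rpow (setIntegral_nonneg measurableSet_Ioi fun t _ => sq_nonneg _)
      (hmain x).2 (by linarith)).trans ?_
    set m := max (A x) (A (x + 1))
    have hmq0 := Real.rpow_nonneg hm0 q
    rw [Real.mul_rpow (by positivity) (hI0 x), Real.mul_rpow (by positivity) (by positivity),
      mul_assoc]
    refine mul_le_mul_of_nonneg_left ?_ (by positivity)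
    have hy := Real.geom_mean_le_arith_mean2_weighted (w₁ := (2 - q) / 2) (w₂ := q / 2)
      (by linarith) (by linarith) hmq0 (hI0 x) (by ring)
    rw [← Real.rpow_mul hm0, show q * ((2 - q) / 2) = (2 - q) * (q / 2) by ring,
      Real.rpow_mul hm0] at hy
    have h1 : (2 - q) / 2 * m ^ q ≤ m ^ q := mul_le_of_le_one_left hmq0 (by linarith)
    have h2 : q / 2 * I x ≤ I x := mul_le_of_le_one_left (hI0 x) (by linarith)
    linarith
  have hΦ : 0 ≤ ∑' x, f x ^ q := tsum_nonneg fun x => Real.rpow_nonneg (hf x) q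
  have hshift : ∑ x ∈ F, A (x + 1) ^ q ≤ 2 * (q * 2 ^ q / (q - 1)) * ∑' x, f x ^ q := by
    have := hA3 (F.image fun x => x + 1)
    rwa [Finset.sum_image fun a _ b _ h => by simpa using h] at this
  refine (Finset.sum_le_sum fun x _ => hpt x).trans ?_
  rw [← Finset.mul_sum, Finset.sum_add_distrib, Finset.sum_add_distrib, mul_assoc]
  refine mul_le_mul_of_nonneg_left ?_ (by positivity)
  have h3 := sum_integral_neighbourForm_le hs hq1 hf F
  have h4 : 4 * (q * 2 ^ q / (q - 1)) * ∑' x, f x ^ q ≤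
      2 ^ q * (4 * (q * 2 ^ q / (q - 1)) * ∑' x, f x ^ q) :=
    le_mul_of_one_le_left (by positivity) (Real.one_le_rpow one_le_two (by linarith))
  linarith [hA3 F]

end

/-- For every `q ∈ (1,2]` there is `c_q > 0` (depending only on `q` and `s`) such that
`‖H f‖_q ≤ c_q ‖f‖_q` for every summable `f`, where
`H f x = (∫₀^∞ |D (P_t f) x|² dt)^{1/2}` and `D f x = f (x+1) - f x`. -/
theorem lq_bound_H (s : ℝ) (hs : s ∈ Set.Ioo (0 : ℝ) 1) (q : ℝ)
    (hq : q ∈ Set.Ioc (1 : ℝ) 2) :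
    ∃ c : ℝ, 0 < c ∧ ∀ f : ℤ → ℝ, Summable f →
      lqNorm q (fun x => Real.sqrt (∫ t in Set.Ioi (0 : ℝ),
        (heat s t f (x + 1) - heat s t f x) ^ 2)) ≤ c * lqNorm q f := by
  have hq1 := hq.1
  have hq2 := hq.2
  have hr : 0 < q - 1 := by linarith
  have hK := symKer_pos hs 1
  set C : ℝ := (q - 1)⁻¹ ^ (q / 2) *
    (2 ^ q * (4 * (q * 2 ^ q / (q - 1))) + 2 / (q * symKer s 1)) with hC
  have hC0 : 0 < C := by positivity
  refine ⟨(2 * (C + C)) ^ (1 / q), by positivity, fun f hf => ?_⟩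
  set g : L1Z := L1Z.ofSummable f hf with hg
  have habs : ∀ x, 0 ≤ |f x| ^ q := fun x => Real.rpow_nonneg (abs_nonneg _) q
  have hfq : Summable fun x => |f x| ^ q := hf.abs.rpow_of_nonneg (fun x => abs_nonneg _) hq1.le
  have hmaxle : ∀ x, max (f x) 0 ≤ |f x| := fun x => max_le (le_abs_self _) (abs_nonneg _)
  have hmaxle' : ∀ x, max (-f x) 0 ≤ |f x| := fun x => max_le (neg_le_abs _) (abs_nonneg _)
  have hsp : Summable fun x => max (f x) 0 :=
    Summable.of_nonneg_of_le (fun x => le_max_right _ _) hmaxle hf.abs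
  have hsn : Summable fun x => max (-f x) 0 :=
    Summable.of_nonneg_of_le (fun x => le_max_right _ _) hmaxle' hf.abs
  set gp : L1Z := L1Z.ofSummable _ hsp with hgp
  set gn : L1Z := L1Z.ofSummable _ hsn with hgn
  have hgp0 : ∀ x, 0 ≤ gp x := fun x => le_max_right _ _
  have hgn0 : ∀ x, 0 ≤ gn x := fun x => le_max_right _ _
  have hsub : g = gp - gn := by
    refine lp.ext (funext fun x => ?_)
    change f x = max (f x) 0 - max (-f x) 0
    rcases le_total 0 (f x) with h | h
    · rw [max_eq_left h, max_eq_right (by linarith), sub_zero]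
    · rw [max_eq_right h, max_eq_left (by linarith), zero_sub, neg_neg]
  have hheat : ∀ t x, heat s t f x = heatOp s t gp x - heatOp s t gn x := fun t x => by
    have h1 : heat s t f x = heatOp s t g x := congrFun (heat_eq_heatOp hs g t) x
    rw [h1, hsub, map_sub]
    rfl
  obtain ⟨hp1, hp2⟩ := sum_integral_sq_rpow_le hs hq hgp0
  obtain ⟨hn1, hn2⟩ := sum_integral_sq_rpow_le hs hq hgn0
  have hΦp : ∑' x, gp x ^ q ≤ ∑' x, |f x| ^ q :=
    ((summable_L1Z gp).rpow_of_nonneg hgp0 hq1.le).tsum_le_tsum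
      (fun x => Real.rpow_le_rpow (hgp0 x) (hmaxle x) (by linarith)) hfq
  have hΦn : ∑' x, gn x ^ q ≤ ∑' x, |f x| ^ q :=
    ((summable_L1Z gn).rpow_of_nonneg hgn0 hq1.le).tsum_le_tsum
      (fun x => Real.rpow_le_rpow (hgn0 x) (hmaxle' x) (by linarith)) hfq
  have hpt : ∀ x, |Real.sqrt (∫ t in Set.Ioi (0 : ℝ),
      (heat s t f (x + 1) - heat s t f x) ^ 2)| ^ q ≤
      2 * ((∫ t in Set.Ioi (0 : ℝ), (heatOp s t gp (x + 1) - heatOp s t gp x) ^ 2) ^ (q / 2) +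
        (∫ t in Set.Ioi (0 : ℝ), (heatOp s t gn (x + 1) - heatOp s t gn x) ^ 2) ^ (q / 2)) := by
    intro x
    set a := ∫ t in Set.Ioi (0 : ℝ), (heatOp s t gp (x + 1) - heatOp s t gp x) ^ 2
    set b := ∫ t in Set.Ioi (0 : ℝ), (heatOp s t gn (x + 1) - heatOp s t gn x) ^ 2
    have ha : 0 ≤ a := setIntegral_nonneg measurableSet_Ioi fun t _ => sq_nonneg _
    have hb : 0 ≤ b := setIntegral_nonneg measurableSet_Ioi fun t _ => sq_nonneg _
    have hle : ∫ t in Set.Ioi (0 : ℝ), (heat s t f (x + 1) - heat s t f x) ^ 2 ≤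
        2 * (a + b) := by
      rw [← integral_add (hp1 x) (hn1 x), ← integral_const_mul]
      refine integral_mono_of_nonneg (Filter.Eventually.of_forall fun t => sq_nonneg _)
        (((hp1 x).add (hn1 x)).const_mul 2) (Filter.Eventually.of_forall fun t => ?_)
      simp only [hheat]
      nlinarith [sq_nonneg ((heatOp s t gp (x + 1) - heatOp s t gp x) +
        (heatOp s t gn (x + 1) - heatOp s t gn x))]
    have hI0 : 0 ≤ ∫ t in Set.Ioi (0 : ℝ), (heat s t f (x + 1) - heat s t f x) ^ 2 :=
      setIntegral_nonneg measurableSet_Ioi fun t _ => sq_nonneg _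
    rw [abs_of_nonneg (Real.sqrt_nonneg _), Real.sqrt_eq_rpow, ← Real.rpow_mul hI0,
      show 1 / 2 * q = q / 2 by ring]
    refine (Real.rpow_le_rpow hI0 hle (by linarith)).trans ?_
    rw [Real.mul_rpow (by norm_num) (by positivity)]
    refine mul_le_mul ?_ (Real.rpow_add_le_add_rpow ha hb (by linarith) (by linarith))
      (by positivity) (by norm_num)
    calc (2 : ℝ) ^ (q / 2) ≤ 2 ^ (1 : ℝ) :=
          Real.rpow_le_rpow_of_exponent_le one_le_two (by linarith)
      _ = 2 := Real.rpow_one 2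
  have hsum : ∑' x, |Real.sqrt (∫ t in Set.Ioi (0 : ℝ),
      (heat s t f (x + 1) - heat s t f x) ^ 2)| ^ q ≤ 2 * (C + C) * ∑' x, |f x| ^ q := by
    refine Real.tsum_le_of_sum_le (fun x => Real.rpow_nonneg (abs_nonneg _) q) fun F => ?_
    refine (Finset.sum_le_sum fun x _ => hpt x).trans ?_
    rw [← Finset.mul_sum, Finset.sum_add_distrib]
    have h1 := (hp2 F).trans (mul_le_mul_of_nonneg_left hΦp hC0.le)
    have h2 := (hn2 F).trans (mul_le_mul_of_nonneg_left hΦn hC0.le)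
    linarith
  rw [lqNorm, lqNorm, ← Real.mul_rpow (by positivity) (tsum_nonneg habs)]
  exact Real.rpow_le_rpow (tsum_nonneg fun x => Real.rpow_nonneg (abs_nonneg _) q) hsum
    (by positivity)
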